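/- For all integers m ≥ 1 and i, j ≥ 1 with j < i, ∫_0^1 h_j^m(r) · r^m P_{i−2}^{(1,m+1)}(2r² − 1) · r dr = ( μ_j^m / (2(m+i)) ) ( 1 − (−1)^{i+j} (j)_m / (i)_m ), and this integral equals 0 when j ≥ i. -/

import Mathlib

open MeasureTheory intervalIntegral

/-- The Jacobi polynomial `P_n^{(0,m)}` via the Rodrigues formula
`P_n^{(0,m)}(x) = ((−1)ⁿ/(2ⁿ n!)) (1+x)^{−m} (d/dx)ⁿ [ (1−x)ⁿ (1+x)^{n+m} ]`. -/
noncomputable def jacobi0 (n m : ℕ) (x : ℝ) : ℝ :=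
  ((-1:ℝ)^n / ((2:ℝ)^n * (Nat.factorial n : ℝ))) *
    iteratedDeriv n (fun y : ℝ => (1 - y)^n * (1 + y)^(n + m)) x / (1 + x)^m

/-- `μ_j^m = 2√(j + (m−1)/2)`. -/
noncomputable def muC (j m : ℕ) : ℝ := 2 * Real.sqrt ((j:ℝ) + ((m:ℝ) - 1)/2)

/-- The radial polynomial `h_j^m(r) = μ_j^m r^m P_{j−1}^{(0,m)}(2r² − 1)`. -/
noncomputable def hRad (j m : ℕ) (r : ℝ) : ℝ :=
  muC j m * r^m * jacobi0 (j - 1) m (2*r^2 - 1)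

/-- The Jacobi polynomial `P_n^{(1,m+1)}` via the Rodrigues formula, indexed by an integer `n`,
with the standard convention that `P_n^{(1,m+1)} = 0` for `n < 0`. -/
noncomputable def jacobi1 (n : ℤ) (m : ℕ) (x : ℝ) : ℝ :=
  if 0 ≤ n then
    ((-1:ℝ)^n.toNat / ((2:ℝ)^n.toNat * (Nat.factorial n.toNat : ℝ))) *
      iteratedDeriv n.toNat (fun y : ℝ => (1 - y)^(n.toNat + 1) * (1 + y)^(n.toNat + m + 1)) x /
        ((1 - x) * (1 + x)^(m + 1))
  else 0

/-- The rising factorial (Pochhammer symbol) `(a)_n = a(a+1)⋯(a+n−1)`, with `(a)_0 = 1`. -/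
noncomputable def poch (a : ℝ) (n : ℕ) : ℝ := (ascPochhammer ℝ n).eval a

open Polynomial

/-- The integral of a polynomial over `[-1, 1]`. -/
noncomputable def symInt (p : ℝ[X]) : ℝ := ∫ x in (-1:ℝ)..1, p.eval x

lemma symInt_add (p q : ℝ[X]) : symInt (p + q) = symInt p + symInt q := by
  simp only [symInt, eval_add]
  exact intervalIntegral.integral_add (p.continuous.intervalIntegrable _ _)
    (q.continuous.intervalIntegrable _ _)

lemma symInt_C_mul (c : ℝ) (p : ℝ[X]) : symInt (C c * p) = c * symInt p := by
  simp [symInt]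

lemma symInt_derivative (p : ℝ[X]) : symInt (derivative p) = p.eval 1 - p.eval (-1) :=
  intervalIntegral.integral_eq_sub_of_hasDerivAt (fun x _ => p.hasDerivAt x)
    (p.derivative.continuous.intervalIntegrable _ _)

lemma symInt_derivative_eq_zero {p : ℝ[X]} (h : (1 - X) * (1 + X) ∣ p) :
    symInt (derivative p) = 0 := by
  obtain ⟨q, rfl⟩ := h
  rw [symInt_derivative]
  simp

lemma iteratedDeriv_polynomial_eval (p : ℝ[X]) (n : ℕ) (x : ℝ) :
    iteratedDeriv n (fun y => p.eval y) x = (derivative^[n] p).eval x := by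
  induction n generalizing p with
  | zero => simp
  | succ n ih =>
    have : deriv (fun y => p.eval y) = fun y => (derivative p).eval y := by
      ext y; simp
    rw [iteratedDeriv_succ', this, ih, Function.iterate_succ_apply]

lemma symInt_iterate_derivative_mul_eq_zero {k : ℕ} {F : ℝ[X]} {G : ℝ[X]}
    (hF : ((1 - X) * (1 + X)) ^ k ∣ F) (hG : derivative^[k] G = 0) :
    symInt (derivative^[k] F * G) = 0 := by
  induction k generalizing G with
  | zero => simp_all [symInt]
  | succ k ih =>
    have h1 := ih ((pow_dvd_pow _ (Nat.le_succ k)).trans hF) (G := derivative G) (by simpa using hG)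
    have h2 : symInt (derivative (derivative^[k] F * G)) = 0 := by
      apply symInt_derivative_eq_zero
      have := pow_sub_dvd_iterate_derivative_of_pow_dvd k hF
      rw [Nat.add_sub_cancel_left, pow_one] at this
      exact this.mul_right G
    rw [derivative_mul, symInt_add, h1, add_zero] at h2
    rwa [Function.iterate_succ_apply']

lemma derivative_linear_pow_mul {L K : ℝ[X]} {b : ℝ} (hL : derivative L = C b) (n : ℕ) :
    derivative (L ^ (n + 1) * K) = L ^ n * (L * derivative K + C ((n + 1) * b) * K) := by
  rw [derivative_mul, derivative_pow, hL]
  simp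
  ring

/-- The value at a root of `L` of the cofactor in `(L ^ (n + m) * K)^{(n)} = L ^ m * P`. -/
lemma eval_of_iterate_derivative_linear_pow_mul {L : ℝ[X]} {b r : ℝ} (hL : derivative L = C b)
    (hL0 : L ≠ 0) (hr : L.eval r = 0) (m n : ℕ) (K P : ℝ[X])
    (h : derivative^[n] (L ^ (n + m) * K) = L ^ m * P) :
    (m.factorial : ℝ) * P.eval r = (n + m).factorial * b ^ n * K.eval r := by
  induction n generalizing K with
  | zero =>
    have : K = P := by simpa [hL0] using h
    simp [this]
  | succ n ih =>
    rw [Function.iterate_succ_apply, show n + 1 + m = n + m + 1 by ring,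
      derivative_linear_pow_mul hL] at h
    rw [ih _ h, show n + 1 + m = n + m + 1 by ring, Nat.factorial_succ]
    simp [hr]
    ring

/-- Integration by parts against the reciprocal of the linear polynomial `L`. -/
lemma symInt_of_iterate_derivative_linear_pow_mul {L M : ℝ[X]} {b : ℝ} (hL : derivative L = C b)
    (hL0 : L ≠ 0) (hLM : L * M = (1 - X) * (1 + X)) (k : ℕ) (K Q : ℝ[X])
    (hK : M ^ k ∣ K) (h : derivative^[k] (L ^ (k + 1) * K) = L * Q) :
    symInt Q = k.factorial * b ^ k * symInt K := by
  induction k generalizing K with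
  | zero =>
    have : K = Q := by simpa [hL0] using h
    simp [this]
  | succ k ih =>
    rw [Function.iterate_succ_apply, derivative_linear_pow_mul hL] at h
    have hK' : M ^ k ∣ K := (pow_dvd_pow _ (Nat.le_succ k)).trans hK
    have hdK : M ^ k ∣ derivative K := by
      simpa using pow_sub_dvd_iterate_derivative_of_pow_dvd 1 hK
    rw [ih _ ((hdK.mul_left _).add (hK'.mul_left _)) h]
    have h2 : symInt (derivative (L * K)) = 0 := by
      apply symInt_derivative_eq_zero
      rw [← hLM]
      exact mul_dvd_mul_left _ ((dvd_pow_self M (Nat.succ_ne_zero k)).trans hK)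
    rw [derivative_mul, hL, symInt_add, symInt_C_mul] at h2
    rw [symInt_add, symInt_C_mul, Nat.factorial_succ]
    push_cast
    linear_combination (k.factorial * b ^ k) * h2

lemma symInt_beta (a b : ℕ) :
    symInt ((1 - X) ^ a * (1 + X) ^ b) * (a + b + 1).factorial =
      2 ^ (a + b + 1) * a.factorial * b.factorial := by
  induction a generalizing b with
  | zero =>
    have h := symInt_derivative ((1 + X) ^ (b + 1))
    have e : derivative ((1 + X) ^ (b + 1) : ℝ[X]) = C ((b:ℝ) + 1) * (1 + X) ^ b := by
      simp [derivative_pow]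
    rw [e, symInt_C_mul] at h
    simp [one_add_one_eq_two] at h
    simp [Nat.factorial_succ]
    linear_combination (b.factorial : ℝ) * h
  | succ a ih =>
    have h : symInt (derivative ((1 - X) ^ (a + 1) * (1 + X) ^ (b + 1))) = 0 :=
      symInt_derivative_eq_zero (mul_dvd_mul (dvd_pow_self _ (by simp)) (dvd_pow_self _ (by simp)))
    have e : derivative ((1 - X) ^ (a + 1) * (1 + X) ^ (b + 1) : ℝ[X]) =
        C (-((a:ℝ) + 1)) * ((1 - X) ^ a * (1 + X) ^ (b + 1)) +
          C ((b:ℝ) + 1) * ((1 - X) ^ (a + 1) * (1 + X) ^ b) := by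
      simp [derivative_mul, derivative_pow]
      ring
    rw [e, symInt_add, symInt_C_mul, symInt_C_mul] at h
    have := ih (b + 1)
    rw [show a + (b + 1) + 1 = a + 1 + b + 1 by ring, Nat.factorial_succ b] at this
    rw [Nat.factorial_succ a]
    push_cast at this ⊢
    have hb : (b:ℝ) + 1 ≠ 0 := by positivity
    apply mul_left_cancel₀ hb
    linear_combination ((a + 1 + b + 1).factorial : ℝ) * h + ((a:ℝ) + 1) * this

lemma one_sub_X_ne_zero : (1 - X : ℝ[X]) ≠ 0 := fun h => by simpa using congrArg (eval 0) h

lemma one_add_X_ne_zero : (1 + X : ℝ[X]) ≠ 0 := fun h => by simpa using congrArg (eval 0) h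

lemma natDegree_one_sub_X : (1 - X : ℝ[X]).natDegree = 1 := by compute_degree!

lemma natDegree_one_add_X : (1 + X : ℝ[X]).natDegree = 1 := by compute_degree!

/-- The cofactor in the Rodrigues formula is a polynomial of degree at most `n`. -/
lemma exists_rodrigues (n a b : ℕ) : ∃ P : ℝ[X], P.natDegree ≤ n ∧
    derivative^[n] ((1 - X) ^ (n + a) * (1 + X) ^ (n + b)) = (1 - X) ^ a * (1 + X) ^ b * P := by
  have hc : IsCoprime ((1 - X : ℝ[X]) ^ a) ((1 + X) ^ b) := by
    apply IsCoprime.pow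
    refine ⟨C (1 / 2), C (1 / 2), ?_⟩
    rw [← mul_add, show (1 - X + (1 + X) : ℝ[X]) = C 2 by rw [C_ofNat]; ring, ← C_mul]
    norm_num
  have h1 : (1 - X : ℝ[X]) ^ a ∣ derivative^[n] ((1 - X) ^ (n + a) * (1 + X) ^ (n + b)) := by
    simpa using pow_sub_dvd_iterate_derivative_of_pow_dvd n
      (dvd_mul_right ((1 - X : ℝ[X]) ^ (n + a)) ((1 + X) ^ (n + b)))
  have h2 : (1 + X : ℝ[X]) ^ b ∣ derivative^[n] ((1 - X) ^ (n + a) * (1 + X) ^ (n + b)) := by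
    simpa using pow_sub_dvd_iterate_derivative_of_pow_dvd n
      (dvd_mul_left ((1 + X : ℝ[X]) ^ (n + b)) ((1 - X) ^ (n + a)))
  obtain ⟨P, hP⟩ := hc.mul_dvd h1 h2
  refine ⟨P, ?_, hP⟩
  by_cases hP0 : P = 0
  · simp [hP0]
  have hd := natDegree_iterate_derivative ((1 - X : ℝ[X]) ^ (n + a) * (1 + X) ^ (n + b)) n
  have e1 := pow_ne_zero a one_sub_X_ne_zero
  have e2 := pow_ne_zero b one_add_X_ne_zero
  rw [hP, natDegree_mul (mul_ne_zero e1 e2) hP0, natDegree_mul e1 e2,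
    natDegree_mul (pow_ne_zero _ one_sub_X_ne_zero) (pow_ne_zero _ one_add_X_ne_zero)] at hd
  simp only [natDegree_pow, natDegree_one_sub_X, natDegree_one_add_X] at hd
  omega

lemma symInt_mul_of_lt {n k m : ℕ} {P Q : ℝ[X]} (hkn : k < n) (hQ : Q.natDegree ≤ k)
    (hP : derivative^[n] ((1 - X) ^ n * (1 + X) ^ (n + m)) = (1 + X) ^ m * P) :
    symInt ((1 + X) ^ m * P * Q) = 0 := by
  rw [← hP]
  apply symInt_iterate_derivative_mul_eq_zero
  · rw [mul_pow]
    exact mul_dvd_mul_left _ (pow_dvd_pow _ (Nat.le_add_right n m))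
  · exact iterate_derivative_eq_zero (hQ.trans_lt hkn)

lemma exists_endpoint_decomposition {P : ℝ[X]} {k : ℕ} (hP : P.natDegree ≤ k) :
    ∃ R : ℝ[X], derivative^[k] R = 0 ∧
      P = C (P.eval 1 / 2) * (1 + X) + C (P.eval (-1) / 2) * (1 - X) + (1 - X) * (1 + X) * R := by
  set S := P - (C (P.eval 1 / 2) * (1 + X) + C (P.eval (-1) / 2) * (1 - X)) with hS
  have hc : IsCoprime (1 - X : ℝ[X]) (1 + X) := by
    refine ⟨C (1 / 2), C (1 / 2), ?_⟩
    rw [← mul_add, show (1 - X + (1 + X) : ℝ[X]) = C 2 by rw [C_ofNat]; ring, ← C_mul]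
    norm_num
  have h1 : (1 - X : ℝ[X]) ∣ S := by
    have : (X - C 1 : ℝ[X]) ∣ S := dvd_iff_isRoot.2 (by simp [hS, IsRoot]; ring)
    rw [← neg_dvd] at this
    simpa using this
  have h2 : (1 + X : ℝ[X]) ∣ S := by
    have : (X - C (-1) : ℝ[X]) ∣ S := dvd_iff_isRoot.2 (by simp [hS, IsRoot]; ring)
    simpa [add_comm] using this
  obtain ⟨R, hR⟩ := hc.mul_dvd h1 h2
  refine ⟨R, ?_, by rw [← hR, hS]; ring⟩
  by_cases hR0 : R = 0
  · simp [hR0]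
  apply iterate_derivative_eq_zero
  have hd : S.natDegree ≤ max k 1 := by
    refine (natDegree_sub_le _ _).trans (max_le_max hP ?_)
    compute_degree
  rw [hR, natDegree_mul (mul_ne_zero one_sub_X_ne_zero one_add_X_ne_zero) hR0,
    natDegree_mul one_sub_X_ne_zero one_add_X_ne_zero, natDegree_one_sub_X,
    natDegree_one_add_X] at hd
  omega

lemma symInt_mul_of_le {n k m : ℕ} {P Q : ℝ[X]} (hnk : n ≤ k) (hPd : P.natDegree ≤ n)
    (hQ : derivative^[k] ((1 - X) ^ (k + 1) * (1 + X) ^ (k + (m + 1))) =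
      (1 - X) ^ 1 * (1 + X) ^ (m + 1) * Q) :
    symInt ((1 + X) ^ m * P * Q) =
      P.eval 1 / 2 * (k.factorial * (-1) ^ k * symInt ((1 + X) ^ (k + (m + 1)))) +
      P.eval (-1) / 2 * (k.factorial * symInt ((1 - X) ^ (k + 1) * (1 + X) ^ m)) := by
  obtain ⟨R, hR, hPR⟩ := exists_endpoint_decomposition (hPd.trans hnk)
  have h0 : symInt (derivative^[k] ((1 - X) ^ (k + 1) * (1 + X) ^ (k + (m + 1))) * R) = 0 := by
    apply symInt_iterate_derivative_mul_eq_zero _ hR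
    rw [mul_pow]
    exact mul_dvd_mul (pow_dvd_pow _ (by omega)) (pow_dvd_pow _ (by omega))
  have h1 := symInt_of_iterate_derivative_linear_pow_mul (L := 1 - X) (M := 1 + X) (b := -1)
    (by simp) one_sub_X_ne_zero rfl k ((1 + X) ^ (k + (m + 1))) ((1 + X) ^ (m + 1) * Q)
    (pow_dvd_pow _ (by omega)) (by rw [hQ]; ring)
  have h2 := symInt_of_iterate_derivative_linear_pow_mul (L := 1 + X) (M := 1 - X) (b := 1)
    (by simp) one_add_X_ne_zero (mul_comm _ _) k ((1 - X) ^ (k + 1) * (1 + X) ^ m)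
    ((1 - X) * (1 + X) ^ m * Q)
    ((pow_dvd_pow _ (by omega)).mul_right _)
    (by rw [show (1 + X : ℝ[X]) ^ (k + 1) * ((1 - X) ^ (k + 1) * (1 + X) ^ m) =
          (1 - X) ^ (k + 1) * (1 + X) ^ (k + (m + 1)) by ring, hQ]; ring)
  have e : (1 + X) ^ m * P * Q = C (P.eval 1 / 2) * ((1 + X) ^ (m + 1) * Q) +
      C (P.eval (-1) / 2) * ((1 - X) * (1 + X) ^ m * Q) +
      derivative^[k] ((1 - X) ^ (k + 1) * (1 + X) ^ (k + (m + 1))) * R := by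
    rw [hQ]
    nth_rw 1 [hPR]
    ring
  rw [e, symInt_add, symInt_add, symInt_C_mul, symInt_C_mul, h0, h1, h2]
  ring

lemma integral_comp_two_mul_sq_sub_one (p : ℝ[X]) :
    ∫ r in (0:ℝ)..1, p.eval (2 * r ^ 2 - 1) * r = symInt p / 4 := by
  have h := intervalIntegral.integral_comp_mul_deriv (a := 0) (b := 1)
    (f := fun r : ℝ => 2 * r ^ 2 - 1) (f' := fun r => 4 * r) (g := fun x => p.eval x)
    (fun r _ => by
      have h : HasDerivAt (fun r : ℝ => 2 * r ^ 2 - 1) (2 * (2 * r)) r := by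
        simpa using ((hasDerivAt_pow 2 r).const_mul 2).sub_const 1
      rwa [← mul_assoc, show (2:ℝ) * 2 = 4 by norm_num] at h)
    (by fun_prop) p.continuous
  norm_num at h
  rw [symInt, ← h, eq_div_iff (by norm_num), ← intervalIntegral.integral_mul_const]
  congr 1; ext r; ring

lemma jacobi0_eq_eval {n m : ℕ} {P : ℝ[X]} {x : ℝ} (hx : 1 + x ≠ 0)
    (hP : derivative^[n] ((1 - X) ^ n * (1 + X) ^ (n + m)) = (1 + X) ^ m * P) :
    jacobi0 n m x = (-1) ^ n / (2 ^ n * n.factorial) * P.eval x := by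
  have h := iteratedDeriv_polynomial_eval ((1 - X) ^ n * (1 + X) ^ (n + m)) n x
  rw [hP] at h
  simp only [eval_mul, eval_pow, eval_sub, eval_add, eval_one, eval_X] at h
  rw [jacobi0, h]
  field_simp

lemma jacobi1_eq_eval {k m : ℕ} {Q : ℝ[X]} {x : ℝ} (hx : 1 + x ≠ 0) (hx' : 1 - x ≠ 0)
    (hQ : derivative^[k] ((1 - X) ^ (k + 1) * (1 + X) ^ (k + (m + 1))) =
      (1 - X) ^ 1 * (1 + X) ^ (m + 1) * Q) :
    jacobi1 k m x = (-1) ^ k / (2 ^ k * k.factorial) * Q.eval x := by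
  have h := iteratedDeriv_polynomial_eval ((1 - X) ^ (k + 1) * (1 + X) ^ (k + (m + 1))) k x
  rw [hQ] at h
  simp only [eval_mul, eval_pow, eval_sub, eval_add, eval_one, eval_X, ← add_assoc] at h
  rw [jacobi1, if_pos (Int.natCast_nonneg k), Int.toNat_natCast, h]
  field_simp

lemma integral_hRad_mul_jacobi1 {n k m : ℕ} {P Q : ℝ[X]}
    (hP : derivative^[n] ((1 - X) ^ n * (1 + X) ^ (n + m)) = (1 + X) ^ m * P)
    (hQ : derivative^[k] ((1 - X) ^ (k + 1) * (1 + X) ^ (k + (m + 1))) =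
      (1 - X) ^ 1 * (1 + X) ^ (m + 1) * Q) :
    ∫ r in (0:ℝ)..1, hRad (n + 1) m r * (r ^ m * jacobi1 k m (2 * r ^ 2 - 1)) * r =
      muC (n + 1) m * ((-1) ^ n / (2 ^ n * n.factorial)) * ((-1) ^ k / (2 ^ k * k.factorial)) *
        (symInt ((1 + X) ^ m * P * Q) / (4 * 2 ^ m)) := by
  set c := muC (n + 1) m * ((-1) ^ n / (2 ^ n * n.factorial)) *
    ((-1) ^ k / (2 ^ k * k.factorial)) / 2 ^ m with hc
  have h : ∫ r in (0:ℝ)..1, hRad (n + 1) m r * (r ^ m * jacobi1 k m (2 * r ^ 2 - 1)) * r =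
      ∫ r in (0:ℝ)..1, (C c * ((1 + X) ^ m * P * Q)).eval (2 * r ^ 2 - 1) * r := by
    apply intervalIntegral.integral_congr_Ioo_of_le (by norm_num)
    rintro r ⟨h0, h1⟩
    have hx : (1:ℝ) + (2 * r ^ 2 - 1) ≠ 0 := by nlinarith [pow_pos h0 2]
    have hx' : (1:ℝ) - (2 * r ^ 2 - 1) ≠ 0 := by nlinarith
    have hp : ((1:ℝ) + (2 * r ^ 2 - 1)) ^ m = 2 ^ m * (r ^ m * r ^ m) := by
      rw [← mul_pow, ← mul_pow]; ring
    simp only [hRad, Nat.add_sub_cancel, jacobi0_eq_eval hx hP, jacobi1_eq_eval hx hx' hQ,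
      eval_mul, eval_C, eval_pow, eval_add, eval_one, eval_X, hp, hc]
    field_simp
  rw [h, integral_comp_two_mul_sq_sub_one, symInt_C_mul, hc]
  field_simp

lemma factorial_mul_poch (n m : ℕ) :
    (n.factorial : ℝ) * poch ((n + 1 : ℕ) : ℝ) m = (n + m).factorial := by
  rw [poch, ← ascPochhammer_eval_cast, ascPochhammer_nat_eq_ascFactorial]
  exact_mod_cast Nat.factorial_mul_ascFactorial n m

/-- for `m ≥ 1` and `i, j ≥ 1`, if `j < i` then
`∫_0^1 h_j^m(r) · r^m P_{i−2}^{(1,m+1)}(2r²−1) · r dr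
  = (μ_j^m/(2(m+i))) (1 − (−1)^{i+j} (j)_m/(i)_m)`,
and the integral vanishes when `j ≥ i`. -/
theorem hRad_jacobi1_integral (m i j : ℕ) (hm : 1 ≤ m) (hi : 1 ≤ i) (hj : 1 ≤ j) :
    (j < i →
      (∫ r in (0:ℝ)..1, hRad j m r * (r^m * jacobi1 ((i:ℤ) - 2) m (2*r^2 - 1)) * r) =
        muC j m / (2*((m:ℝ) + (i:ℝ))) *
          (1 - (-1:ℝ)^(i + j) * (poch (j:ℝ) m / poch (i:ℝ) m))) ∧
    (i ≤ j →
      (∫ r in (0:ℝ)..1, hRad j m r * (r^m * jacobi1 ((i:ℤ) - 2) m (2*r^2 - 1)) * r) = 0) := by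
  rcases Nat.lt_or_ge i 2 with hi2 | hi2
  · obtain rfl : i = 1 := by omega
    exact ⟨fun h => absurd h (by omega), fun _ => by simp [jacobi1]⟩
  obtain ⟨k, rfl⟩ := Nat.exists_eq_add_of_le' hi2
  obtain ⟨n, rfl⟩ := Nat.exists_eq_add_of_le' hj
  obtain ⟨P, hPd, hP⟩ := exists_rodrigues n 0 m
  obtain ⟨Q, hQd, hQ⟩ := exists_rodrigues k 1 (m + 1)
  rw [add_zero, pow_zero, one_mul] at hP
  have hk : ((k + 2 : ℕ) : ℤ) - 2 = k := by push_cast; ring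
  rw [hk, integral_hRad_mul_jacobi1 hP hQ]
  refine ⟨fun h => ?_, fun h => ?_⟩
  · have hP1 := eval_of_iterate_derivative_linear_pow_mul (L := 1 - X) (b := -1) (r := 1)
      (by simp) one_sub_X_ne_zero (by simp) 0 n ((1 + X) ^ (n + m)) ((1 + X) ^ m * P)
      (by simpa using hP)
    have hP0 := eval_of_iterate_derivative_linear_pow_mul (L := 1 + X) (b := 1) (r := -1)
      (by simp) one_add_X_ne_zero (by simp) m n ((1 - X) ^ n) P (by rw [← hP, mul_comm])
    have hB1 := symInt_beta 0 (k + (m + 1))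
    have hB0 := symInt_beta (k + 1) m
    rw [symInt_mul_of_le (by omega) hPd hQ]
    have hpn := factorial_mul_poch n m
    have hpk := factorial_mul_poch (k + 1) m
    simp only [eval_mul, eval_pow, eval_sub, eval_add, eval_one, eval_X, add_zero, zero_add,
      Nat.factorial_zero, Nat.cast_one, one_mul, one_add_one_eq_two, sub_neg_eq_add, one_pow,
      mul_one, pow_zero] at hP1 hP0 hB1 hB0
    have fn : (n.factorial : ℝ) ≠ 0 := by positivity
    have fm : (m.factorial : ℝ) ≠ 0 := by positivity
    have fk : (k.factorial : ℝ) ≠ 0 := by positivity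
    have fk1 : ((k + 1).factorial : ℝ) ≠ 0 := by positivity
    have fkm : ((k + m + 1).factorial : ℝ) ≠ 0 := by positivity
    have e1 : P.eval 1 = n.factorial * (-1) ^ n * 2 ^ n := by
      apply mul_left_cancel₀ (pow_ne_zero m (two_ne_zero (α := ℝ)))
      rw [hP1, pow_add]; ring
    have e0 : P.eval (-1) = (n + m).factorial * 2 ^ n / m.factorial := by
      rw [eq_div_iff fm, mul_comm, hP0]
    have s1 : symInt ((1 + X) ^ (k + (m + 1))) = 2 ^ (k + m + 2) / (k + m + 2) := by
      rw [show k + (m + 1) + 1 = (k + m + 1) + 1 by ring, Nat.factorial_succ,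
        show k + (m + 1) = k + m + 1 by ring] at hB1
      rw [show k + (m + 1) = k + m + 1 by ring, eq_div_iff (by positivity)]
      apply mul_right_cancel₀ fkm
      push_cast at hB1
      linear_combination hB1
    have s0 : symInt ((1 - X) ^ (k + 1) * (1 + X) ^ m) =
        2 ^ (k + m + 2) * (k + 1).factorial * m.factorial /
          ((k + m + 2) * (k + m + 1).factorial) := by
      rw [show k + 1 + m + 1 = (k + m + 1) + 1 by ring, Nat.factorial_succ] at hB0
      rw [eq_div_iff (by positivity)]
      push_cast at hB0
      linear_combination hB0
    have p1 : poch ((n + 1 : ℕ) : ℝ) m = (n + m).factorial / n.factorial := by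
      rw [eq_div_iff fn, mul_comm, hpn]
    have p2 : poch ((k + 2 : ℕ) : ℝ) m = (k + m + 1).factorial / (k + 1).factorial := by
      rw [eq_div_iff fk1, mul_comm, hpk, show k + 1 + m = k + m + 1 by ring]
    rw [e1, e0, s1, s0, p1, p2]
    have sk : ((-1:ℝ) ^ k) * (-1) ^ k = 1 := by rw [← mul_pow]; simp
    have sn : ((-1:ℝ) ^ n) * (-1) ^ n = 1 := by rw [← mul_pow]; simp
    have hs : (-1:ℝ) ^ (k + 2 + (n + 1)) = -((-1) ^ k * (-1) ^ n) := by ring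
    rw [hs]
    push_cast
    generalize (-1:ℝ) ^ k = u at *
    generalize (-1:ℝ) ^ n = v at *
    have hkm : (k:ℝ) + m + 2 ≠ 0 := by positivity
    rw [show (m:ℝ) + (k + 2) = k + m + 2 by ring]
    field_simp
    linear_combination (muC (n + 1) m * n.factorial * (k + m + 1).factorial * 2 ^ k * 2 ^ m * 4) *
      (u ^ 2 * sn + sk)
  · rw [symInt_mul_of_lt (by omega) hQd hP]
    simp
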